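/- arXiv:2303.10363 — 3 statements merged into one kernel-verified Lean document; each statement's English description precedes it below -/
import Mathlib

section
/- The algebra homomorphism from the complex group algebra ℂ[F] (the monoid algebra of Thompson's group F over ℂ) to the ℂ-linear endomorphisms of the vector space of finitely supported functions F/H₂ → ℂ, induced by the action of F on the left coset space F/H₂ by left translations, is injective. (That is, the permutation representation π₂ of F on ℓ²(F/H₂) is faithful on ℂ[F].) -/
open Set MeasureTheory Filter Topology

/-- The binary Cantor space. -/
abbrev CantorC : Type := ℕ → Bool

/-- Finite binary words. -/
abbrev BWord : Type := List Bool

/-- Prepend a finite word to an infinite binary sequence. -/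
def wordApp (w : BWord) (x : CantorC) : CantorC := fun n =>
  if h : n < w.length then w.get ⟨n, h⟩ else x (n - w.length)

/-- The cylinder of sequences beginning with the word `w`. -/
def cyl (w : BWord) : Set CantorC := Set.range (wordApp w)

/-- `J` is a code: both the α-cylinders and the β-cylinders form a partition of the
Cantor space (every point lies in the cylinder of exactly one pair). -/
def IsCode (J : Finset (BWord × BWord)) : Prop :=
  (∀ x : CantorC, ∃! p : BWord × BWord, p ∈ J ∧ x ∈ cyl p.1) ∧
  (∀ x : CantorC, ∃! p : BWord × BWord, p ∈ J ∧ x ∈ cyl p.2)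

/-- `J` is order preserving: α ≺ α' lexicographically iff β ≺ β' lexicographically. -/
def OrdPres (J : Finset (BWord × BWord)) : Prop :=
  ∀ p ∈ J, ∀ q ∈ J, (List.Lex (· < ·) p.1 q.1 ↔ List.Lex (· < ·) p.2 q.2)

/-- The bijection `g` is induced by the code `J` : it maps `β·x` to `α·x`. -/
def InducedBy (J : Finset (BWord × BWord)) (g : Equiv.Perm CantorC) : Prop :=
  ∀ p ∈ J, ∀ x : CantorC, g (wordApp p.2 x) = wordApp p.1 x

/-- `J` is an order-preserving code inducing the bijection `g`. -/
def IsCodeFor (J : Finset (BWord × BWord)) (g : Equiv.Perm CantorC) : Prop :=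
  IsCode J ∧ OrdPres J ∧ InducedBy J g

/-- Membership in (the realization on the Cantor space of) Thompson's group `F`. -/
def InF (g : Equiv.Perm CantorC) : Prop := ∃ J, IsCodeFor J g

/-- The pair `(α, β)` has `|α| ≡ |β| (mod 2)`. -/
def EvenPair (p : BWord × BWord) : Prop := p.1.length % 2 = p.2.length % 2

/-- Membership in the subgroup `H₂` : some order-preserving code for `g` has all
pairs of even length difference. -/
def InH2 (g : Equiv.Perm CantorC) : Prop :=
  ∃ J, IsCodeFor J g ∧ ∀ p ∈ J, EvenPair p

/-- The union of the α-cylinders over pairs of even length difference. -/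
def pSet (J : Finset (BWord × BWord)) : Set CantorC :=
  {x | ∃ p ∈ J, EvenPair p ∧ x ∈ cyl p.1}

/-- The union of the β-cylinders over pairs of even length difference. -/
def eSet (J : Finset (BWord × BWord)) : Set CantorC :=
  {x | ∃ p ∈ J, EvenPair p ∧ x ∈ cyl p.2}

/-- `p_f` : for `f ∈ F` this equals `pSet J` for any (equivalently, every)
order-preserving code `J` for `f`. -/
def pF (g : Equiv.Perm CantorC) : Set CantorC :=
  ⋃ J ∈ {J : Finset (BWord × BWord) | IsCodeFor J g}, pSet J

/-- `E_f` : for `f ∈ F` this equals `eSet J` for any (equivalently, every)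
order-preserving code `J` for `f`. -/
def EF (g : Equiv.Perm CantorC) : Set CantorC :=
  ⋃ J ∈ {J : Finset (BWord × BWord) | IsCodeFor J g}, eSet J

/-- `Ω₂ = {p_f : f ∈ F}`. -/
def Omega2 : Set (Set CantorC) := {p | ∃ g, InF g ∧ pF g = p}

/-- The action `f · p = f(p ∩ E_f) ∪ f((C ∖ p) ∩ (C ∖ E_f))`. -/
def actF (g : Equiv.Perm CantorC) (p : Set CantorC) : Set CantorC :=
  g '' (p ∩ EF g) ∪ g '' (pᶜ ∩ (EF g)ᶜ)

open Classical in
/-- `T(p)` as a Boolean-valued characteristic function: `T(p) w = true` iff the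
cylinder of `w` meets `p`. -/
noncomputable def Tb (p : Set CantorC) : BWord → Bool :=
  fun w => if (cyl w ∩ p).Nonempty then true else false

/-- The embedding `p ↦ (T(p), T(C ∖ p))`. -/
noncomputable def embedT (p : Set CantorC) : (BWord → Bool) × (BWord → Bool) :=
  (Tb p, Tb pᶜ)

/-- `Ω̄₂` : the closure of the image of `Ω₂` under the embedding. -/
noncomputable def OmegaBar : Set ((BWord → Bool) × (BWord → Bool)) :=
  closure (embedT '' Omega2)

/-- Thompson's group `F`, as a subgroup of the permutation group of the Cantor space.
Since `{g | InF g}` is a subgroup (Statement 0), its closure equals itself. -/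
def FGrp : Subgroup (Equiv.Perm CantorC) := Subgroup.closure {g | InF g}

/-- The subgroup `H₂` of `F`. Since `{g | InH2 g}` is a subgroup (Statement 4),
its closure equals itself. -/
def H2Sub : Subgroup FGrp := Subgroup.closure {g : FGrp | InH2 (g : Equiv.Perm CantorC)}

section Germs

/-- Near `y`, the map `g` replaces the first `n` letters of `y` by the first `m` letters
of `g y`. -/
def IsGerm (g : CantorC → CantorC) (y : CantorC) (m n : ℕ) : Prop :=
  ∀ x : CantorC, (∀ i < n, x i = y i) → (∀ i, g x (m + i) = x (n + i)) ∧ ∀ i < m, g x i = g y i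

/-- Near `y`, the map `g` is a prefix replacement changing lengths by `d` modulo 2. -/
def HasParity (g : CantorC → CantorC) (y : CantorC) (d : ZMod 2) : Prop :=
  ∃ m n : ℕ, IsGerm g y m n ∧ (m : ZMod 2) + n = d

lemma IsGerm.add {g : CantorC → CantorC} {y : CantorC} {m n : ℕ} (h : IsGerm g y m n) (k : ℕ) :
    IsGerm g y (m + k) (n + k) := by
  intro x hx
  obtain ⟨h1, h2⟩ := h x fun i hi => hx i (by omega)
  refine ⟨fun i => by rw [add_assoc, h1, add_assoc], fun i hi => ?_⟩
  by_cases him : i < m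
  · exact h2 i him
  · obtain ⟨j, rfl⟩ := Nat.exists_eq_add_of_le (not_lt.mp him)
    rw [h1, (h y fun _ _ => rfl).1]
    exact hx _ (by omega)

lemma IsGerm.of_agree {g : CantorC → CantorC} {y z : CantorC} {m n : ℕ} (h : IsGerm g y m n)
    (hz : ∀ i < n, z i = y i) : IsGerm g z m n := by
  intro x hx
  obtain ⟨h1, h2⟩ := h x fun i hi => (hx i hi).trans (hz i hi)
  exact ⟨h1, fun i hi => (h2 i hi).trans ((h z hz).2 i hi).symm⟩

lemma IsGerm.comp {f g : CantorC → CantorC} {y : CantorC} {p m n : ℕ}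
    (hf : IsGerm f (g y) p m) (hg : IsGerm g y m n) : IsGerm (f ∘ g) y p n := by
  intro x hx
  obtain ⟨h1, h2⟩ := hg x hx
  obtain ⟨h3, h4⟩ := hf (g x) h2
  exact ⟨fun i => (h3 i).trans (h1 i), h4⟩

lemma IsGerm.symm {g : Equiv.Perm CantorC} {y : CantorC} {m n : ℕ} (hg : IsGerm g y m n) :
    IsGerm g.symm (g y) n m := by
  intro x hx
  set z : CantorC := fun i => if i < n then y i else x (m + (i - n)) with hz
  have hzy : ∀ i < n, z i = y i := fun i hi => by simp [hz, hi]
  obtain ⟨h1, h2⟩ := hg z hzy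
  have hgz : g z = x := by
    funext i
    by_cases him : i < m
    · rw [h2 i him, hx i him]
    · obtain ⟨j, rfl⟩ := Nat.exists_eq_add_of_le (not_lt.mp him)
      rw [h1]
      simp [hz]
  have hgx : g.symm x = z := by rw [← hgz, Equiv.symm_apply_apply]
  rw [hgx, Equiv.symm_apply_apply]
  exact ⟨fun i => by simp [hz], hzy⟩

lemma IsGerm.not_lt {g : CantorC → CantorC} {y : CantorC} {m m' n : ℕ} (h : IsGerm g y m n)
    (h' : IsGerm g y m' n) : ¬ m < m' := by
  intro hlt
  set x : CantorC := Function.update y n (!y n) with hx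
  have hxy : ∀ i < n, x i = y i := fun i hi => by simp [hx, hi.ne]
  have h1 := (h x hxy).1 0
  have h2 := (h y fun _ _ => rfl).1 0
  have h3 := (h' x hxy).2 m hlt
  simp only [add_zero] at h1 h2
  rw [h1, h2] at h3
  simp [hx] at h3

lemma HasParity.unique {g : CantorC → CantorC} {y : CantorC} {d e : ZMod 2}
    (hd : HasParity g y d) (he : HasParity g y e) : d = e := by
  obtain ⟨m, n, h, rfl⟩ := hd
  obtain ⟨m', n', h', rfl⟩ := he
  have h1 := h.add n'
  have h2 := h'.add n
  rw [add_comm n' n] at h2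
  have h3 : m + n' = m' + n := le_antisymm (not_lt.mp (h2.not_lt h1)) (not_lt.mp (h1.not_lt h2))
  have h4 : (m : ZMod 2) + n' = m' + n := by exact_mod_cast congrArg (Nat.cast (R := ZMod 2)) h3
  have h5 : ∀ a b c d : ZMod 2, a + d = c + b → a + b = c + d := by decide
  exact h5 _ _ _ _ h4

lemma HasParity.comp {f g : CantorC → CantorC} {y : CantorC} {d e : ZMod 2}
    (hf : HasParity f (g y) d) (hg : HasParity g y e) : HasParity (f ∘ g) y (d + e) := by
  obtain ⟨p, q, hf, rfl⟩ := hf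
  obtain ⟨m, n, hg, rfl⟩ := hg
  have h1 := hf.add m
  have h2 := hg.add q
  rw [add_comm q m] at h1
  refine ⟨_, _, h1.comp h2, ?_⟩
  push_cast
  ring

lemma HasParity.symm {g : Equiv.Perm CantorC} {y : CantorC} {d : ZMod 2} (hg : HasParity g y d) :
    HasParity g.symm (g y) d := by
  obtain ⟨m, n, hg, rfl⟩ := hg
  exact ⟨n, m, hg.symm, add_comm _ _⟩

lemma hasParity_id (y : CantorC) : HasParity id y 0 :=
  ⟨0, 0, fun x _ => ⟨fun _ => rfl, fun i hi => absurd hi (Nat.not_lt_zero i)⟩, by simp⟩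

end Germs

section Membership

lemma isGerm_wordApp {g : CantorC → CantorC} {α β : BWord} (y : CantorC) (hy : y ∈ cyl β)
    (h : ∀ x, g (wordApp β x) = wordApp α x) : IsGerm g y α.length β.length := by
  obtain ⟨t, rfl⟩ := hy
  intro x hx
  have hxe : x = wordApp β fun i => x (β.length + i) := by
    funext i
    by_cases hi : i < β.length
    · rw [hx i hi]
      simp [wordApp, hi]
    · simp [wordApp, hi, Nat.add_sub_of_le (not_lt.mp hi)]
  rw [hxe, h, h]
  refine ⟨fun i => by simp [wordApp], fun i hi => by simp [wordApp, hi]⟩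

lemma IsCodeFor.hasParity {J : Finset (BWord × BWord)} {g : Equiv.Perm CantorC}
    (h : IsCodeFor J g) (y : CantorC) :
    ∃ p ∈ J, HasParity g y ((p.1.length : ZMod 2) + p.2.length) := by
  obtain ⟨p, ⟨hp, hy⟩, -⟩ := h.1.2 y
  exact ⟨p, hp, _, _, isGerm_wordApp y hy (h.2.2 p hp), rfl⟩

lemma exists_hasParity_of_mem_FGrp {g : Equiv.Perm CantorC} (hg : g ∈ FGrp) (y : CantorC) :
    ∃ d, HasParity g y d := by
  induction hg using Subgroup.closure_induction generalizing y with
  | mem g hg =>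
    obtain ⟨J, hJ⟩ := hg
    obtain ⟨p, -, hp⟩ := hJ.hasParity y
    exact ⟨_, hp⟩
  | one => exact ⟨0, hasParity_id y⟩
  | mul f g _ _ hf hg =>
    obtain ⟨d, hd⟩ := hf (g y)
    obtain ⟨e, he⟩ := hg y
    exact ⟨d + e, hd.comp he⟩
  | inv g _ hg =>
    obtain ⟨d, hd⟩ := hg (g.symm y)
    have := hd.symm
    rw [Equiv.apply_symm_apply] at this
    exact ⟨d, this⟩

lemma hasParity_zero_of_mem_H2Sub {g : FGrp} (hg : g ∈ H2Sub) (y : CantorC) :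
    HasParity (g : Equiv.Perm CantorC) y 0 := by
  induction hg using Subgroup.closure_induction generalizing y with
  | mem g hg =>
    obtain ⟨J, hJ, he⟩ := hg
    obtain ⟨p, hpJ, hp⟩ := hJ.hasParity y
    have h1 : (p.1.length : ZMod 2) = p.2.length := (ZMod.natCast_eq_natCast_iff _ _ _).2 (he p hpJ)
    rwa [h1, CharTwo.add_self_eq_zero] at hp
  | one => exact hasParity_id y
  | mul f g _ _ hf hg => simpa using (hf ((g : Equiv.Perm CantorC) y)).comp (hg y)
  | inv g _ hg =>
    have := (hg ((g : Equiv.Perm CantorC).symm y)).symm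
    rwa [Equiv.apply_symm_apply] at this

end Membership

section Bumps

/-- Prepend a letter to an infinite binary sequence. -/
def seqCons (b : Bool) (x : CantorC) : CantorC
  | 0 => b
  | n + 1 => x n

/-- Drop the first letter of an infinite binary sequence. -/
def seqTail (x : CantorC) : CantorC := fun n => x (n + 1)

@[simp] lemma seqCons_zero (b : Bool) (x : CantorC) : seqCons b x 0 = b := rfl

@[simp] lemma seqCons_succ (b : Bool) (x : CantorC) (n : ℕ) : seqCons b x (n + 1) = x n := rfl

@[simp] lemma seqTail_apply (x : CantorC) (n : ℕ) : seqTail x n = x (n + 1) := rfl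

@[simp] lemma seqTail_seqCons (b : Bool) (x : CantorC) : seqTail (seqCons b x) = x := rfl

lemma seqCons_seqTail {b : Bool} {x : CantorC} (h : x 0 = b) : seqCons b (seqTail x) = x := by
  subst h
  funext n
  cases n <;> rfl

@[simp] lemma wordApp_nil (x : CantorC) : wordApp [] x = x := by
  funext n
  simp [wordApp]

@[simp] lemma wordApp_cons (b : Bool) (w : BWord) (x : CantorC) :
    wordApp (b :: w) x = seqCons b (wordApp w x) := by
  funext n
  cases n <;> simp [wordApp]

@[simp] lemma mem_cyl_nil (x : CantorC) : x ∈ cyl [] := ⟨x, wordApp_nil x⟩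

@[simp] lemma mem_cyl_cons (b : Bool) (w : BWord) (x : CantorC) :
    x ∈ cyl (b :: w) ↔ x 0 = b ∧ seqTail x ∈ cyl w := by
  constructor
  · rintro ⟨t, rfl⟩
    simp [cyl]
  · rintro ⟨h, t, ht⟩
    exact ⟨t, by rw [wordApp_cons, ht, seqCons_seqTail h]⟩

/-- The permutation acting as `g` on the cylinder of the letter `b`, and trivially elsewhere. -/
def consPerm (b : Bool) (g : Equiv.Perm CantorC) : Equiv.Perm CantorC where
  toFun x := if x 0 = b then seqCons b (g (seqTail x)) else x
  invFun x := if x 0 = b then seqCons b (g.symm (seqTail x)) else x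
  left_inv x := by
    by_cases h : x 0 = b
    · simp [h, seqCons_seqTail]
    · simp [h]
  right_inv x := by
    by_cases h : x 0 = b
    · simp [h, seqCons_seqTail]
    · simp [h]

lemma consPerm_of_eq {b : Bool} (g : Equiv.Perm CantorC) {x : CantorC} (h : x 0 = b) :
    consPerm b g x = seqCons b (g (seqTail x)) := if_pos h

lemma consPerm_of_ne {b : Bool} (g : Equiv.Perm CantorC) {x : CantorC} (h : x 0 ≠ b) :
    consPerm b g x = x := if_neg h

/-- The code of `consPerm b g` obtained from a code of `g`. -/
def consCode (b : Bool) (J : Finset (BWord × BWord)) : Finset (BWord × BWord) :=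
  insert ([!b], [!b]) (J.image fun p => (b :: p.1, b :: p.2))

lemma mem_consCode {b : Bool} {J : Finset (BWord × BWord)} {p : BWord × BWord} :
    p ∈ consCode b J ↔ p = ([!b], [!b]) ∨ ∃ q ∈ J, (b :: q.1, b :: q.2) = p := by
  simp [consCode]

lemma existsUnique_mem_consCode (b : Bool) {J : Finset (BWord × BWord)}
    (π : BWord × BWord → BWord) (hπ : π ([!b], [!b]) = [!b])
    (hπ' : ∀ q : BWord × BWord, π (b :: q.1, b :: q.2) = b :: π q)
    (h : ∀ x : CantorC, ∃! p : BWord × BWord, p ∈ J ∧ x ∈ cyl (π p)) (x : CantorC) :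
    ∃! p : BWord × BWord, p ∈ consCode b J ∧ x ∈ cyl (π p) := by
  by_cases hx : x 0 = b
  · obtain ⟨p, ⟨hp, hxp⟩, hu⟩ := h (seqTail x)
    refine ⟨(b :: p.1, b :: p.2), ⟨mem_consCode.2 (Or.inr ⟨p, hp, rfl⟩), ?_⟩, ?_⟩
    · rw [hπ']
      simp [hx, hxp]
    · rintro q ⟨hq, hxq⟩
      rcases mem_consCode.1 hq with rfl | ⟨r, hr, rfl⟩
      · rw [hπ] at hxq
        simp [hx] at hxq
      · rw [hπ', mem_cyl_cons] at hxq
        rw [hu r ⟨hr, hxq.2⟩]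
  · refine ⟨([!b], [!b]), ⟨mem_consCode.2 (Or.inl rfl), ?_⟩, ?_⟩
    · rw [hπ]
      simpa [Bool.eq_not] using hx
    · rintro q ⟨hq, hxq⟩
      rcases mem_consCode.1 hq with rfl | ⟨r, hr, rfl⟩
      · rfl
      · rw [hπ', mem_cyl_cons] at hxq
        exact absurd hxq.1 hx

lemma InF.consPerm {g : Equiv.Perm CantorC} (hg : InF g) (b : Bool) : InF (consPerm b g) := by
  obtain ⟨J, hJ, hord, hind⟩ := hg
  refine ⟨consCode b J, ⟨existsUnique_mem_consCode b Prod.fst rfl (fun _ => rfl) hJ.1,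
    existsUnique_mem_consCode b Prod.snd rfl (fun _ => rfl) hJ.2⟩, ?_, ?_⟩
  · intro p hp q hq
    rcases mem_consCode.1 hp with rfl | ⟨r, hr, rfl⟩ <;>
      rcases mem_consCode.1 hq with rfl | ⟨s, hs, rfl⟩
    · rfl
    · cases b <;> simp [List.cons_lex_cons_iff]
    · cases b <;> simp [List.cons_lex_cons_iff]
    · have := hord r hr s hs
      simpa [List.cons_lex_cons_iff] using this
  · intro p hp x
    rcases mem_consCode.1 hp with rfl | ⟨r, hr, rfl⟩
    · simp [consPerm_of_ne g (x := seqCons (!b) x) (b := b) (by simp)]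
    · rw [consPerm_of_eq] <;> simp [hind r hr]

lemma HasParity.consPerm {g : Equiv.Perm CantorC} {x : CantorC} {d : ZMod 2} {b : Bool}
    (hx : x 0 = b) (h : HasParity g (seqTail x) d) : HasParity (consPerm b g) x d := by
  obtain ⟨m, n, h, rfl⟩ := h
  refine ⟨m + 1, n + 1, fun y hy => ?_, ?_⟩
  · have hy0 : y 0 = b := (hy 0 n.succ_pos).trans hx
    obtain ⟨h1, h2⟩ := h (seqTail y) fun i hi => hy (i + 1) (by omega)
    rw [consPerm_of_eq g hy0, consPerm_of_eq g hx]
    refine ⟨fun i => ?_, fun i hi => ?_⟩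
    · rw [Nat.add_right_comm, seqCons_succ, h1, seqTail_apply, Nat.add_right_comm]
    · cases i with
      | zero => rfl
      | succ i => exact h2 i (by omega)
  · push_cast
    have : ∀ a c : ZMod 2, a + 1 + (c + 1) = a + c := by decide
    exact this _ _

lemma hasParity_consPerm_of_ne {g : Equiv.Perm CantorC} {x : CantorC} {b : Bool}
    (hx : x 0 ≠ b) : HasParity (consPerm b g) x 0 := by
  refine ⟨1, 1, fun y hy => ?_, by decide⟩
  have hy0 : y 0 ≠ b := by rwa [hy 0 one_pos]
  rw [consPerm_of_ne g hy0, consPerm_of_ne g hx]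
  exact ⟨fun _ => rfl, hy⟩

/-- The generator `00 ↦ 0`, `01 ↦ 10`, `1 ↦ 11` of Thompson's group. -/
def thompsonGen : Equiv.Perm CantorC where
  toFun x := if x 0 then seqCons true x else
    if x 1 then seqCons true (seqCons false (seqTail (seqTail x))) else seqTail x
  invFun x := if x 0 then
      if x 1 then seqTail x else seqCons false (seqCons true (seqTail (seqTail x)))
    else seqCons false x
  left_inv x := by
    have e (b c) (h : x 0 = b) (h' : x 1 = c) :
        seqCons b (seqCons c (seqTail (seqTail x))) = x := by
      rw [seqCons_seqTail (x := seqTail x) h', seqCons_seqTail h]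
    cases h0 : x 0 <;> cases h1 : x 1 <;> simp_all [seqCons, seqCons_seqTail]
  right_inv x := by
    have e (b c) (h : x 0 = b) (h' : x 1 = c) :
        seqCons b (seqCons c (seqTail (seqTail x))) = x := by
      rw [seqCons_seqTail (x := seqTail x) h', seqCons_seqTail h]
    cases h0 : x 0 <;> cases h1 : x 1 <;> simp_all [seqCons, seqCons_seqTail]

lemma inF_thompsonGen : InF thompsonGen := by
  refine ⟨{([false], [false, false]), ([true, false], [false, true]), ([true, true], [true])},
    ⟨fun x => ?_, fun x => ?_⟩, ?_, ?_⟩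
  · cases h0 : x 0 <;> cases h1 : x 1
    · exact ⟨([false], [false, false]), by simp [h0], by simp +contextual [or_imp, h0, h1]⟩
    · exact ⟨([false], [false, false]), by simp [h0], by simp +contextual [or_imp, h0, h1]⟩
    · exact ⟨([true, false], [false, true]), by simp [h0, h1], by simp +contextual [or_imp, h0, h1]⟩
    · exact ⟨([true, true], [true]), by simp [h0, h1], by simp +contextual [or_imp, h0, h1]⟩
  · cases h0 : x 0 <;> cases h1 : x 1
    · exact ⟨([false], [false, false]), by simp [h0, h1], by simp +contextual [or_imp, h0, h1]⟩
    · exact ⟨([true, false], [false, true]), by simp [h0, h1], by simp +contextual [or_imp, h0, h1]⟩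
    · exact ⟨([true, true], [true]), by simp [h0], by simp +contextual [or_imp, h0, h1]⟩
    · exact ⟨([true, true], [true]), by simp [h0], by simp +contextual [or_imp, h0, h1]⟩
  · intro p hp q hq
    simp only [Finset.mem_insert, Finset.mem_singleton] at hp hq
    rcases hp with rfl | rfl | rfl <;> rcases hq with rfl | rfl | rfl <;>
      simp [List.cons_lex_cons_iff]
  · intro p hp x
    simp only [Finset.mem_insert, Finset.mem_singleton] at hp
    rcases hp with rfl | rfl | rfl <;> simp [thompsonGen, seqCons]

lemma InF.symm {g : Equiv.Perm CantorC} (hg : InF g) : InF g.symm := by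
  obtain ⟨J, hJ, hord, hind⟩ := hg
  have key (π : BWord × BWord → BWord) (h : ∀ x : CantorC, ∃! p, p ∈ J ∧ x ∈ cyl (π p.swap))
      (x : CantorC) : ∃! p, p ∈ J.image Prod.swap ∧ x ∈ cyl (π p) := by
    obtain ⟨p, ⟨hp, hx⟩, hu⟩ := h x
    refine ⟨p.swap, ⟨Finset.mem_image_of_mem _ hp, hx⟩, ?_⟩
    rintro q ⟨hq, hxq⟩
    obtain ⟨r, hr, rfl⟩ := Finset.mem_image.1 hq
    rw [hu r ⟨hr, hxq⟩]
  refine ⟨J.image Prod.swap, ⟨key Prod.fst hJ.2, key Prod.snd hJ.1⟩, ?_, ?_⟩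
  · intro p hp q hq
    obtain ⟨r, hr, rfl⟩ := Finset.mem_image.1 hp
    obtain ⟨s, hs, rfl⟩ := Finset.mem_image.1 hq
    exact (hord r hr s hs).symm
  · intro p hp x
    obtain ⟨r, hr, rfl⟩ := Finset.mem_image.1 hp
    rw [Equiv.symm_apply_eq]
    exact (hind r hr x).symm

lemma exists_odd_at (z : CantorC) : ∃ h, InF h ∧ HasParity h z 1 := by
  cases h0 : z 0 with
  | true =>
    refine ⟨thompsonGen, inF_thompsonGen, 2, 1,
      isGerm_wordApp (α := [true, true]) (β := [true]) z (by simp [h0]) ?_, by decide⟩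
    simp [thompsonGen]
  | false =>
    refine ⟨thompsonGen.symm, inF_thompsonGen.symm, 2, 1,
      isGerm_wordApp (α := [false, false]) (β := [false]) z (by simp [h0]) ?_, by decide⟩
    simp [thompsonGen]

lemma exists_bump (N : ℕ) (z : CantorC) : ∃ h, InF h ∧ HasParity h z 1 ∧ (∀ i < N, h z i = z i) ∧
    ∀ x : CantorC, (∃ i < N, x i ≠ z i) → h x = x ∧ HasParity h x 0 := by
  induction N generalizing z with
  | zero =>
    obtain ⟨h, hF, hz⟩ := exists_odd_at z
    exact ⟨h, hF, hz, by simp, by simp⟩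
  | succ N ih =>
    obtain ⟨h, hF, hz, hfix, htriv⟩ := ih (seqTail z)
    refine ⟨consPerm (z 0) h, hF.consPerm _, hz.consPerm rfl, fun i hi => ?_, fun x hx => ?_⟩
    · rw [consPerm_of_eq h rfl]
      cases i with
      | zero => rfl
      | succ i => exact hfix i (by omega)
    · by_cases hx0 : x 0 = z 0
      · obtain ⟨h1, h2⟩ := htriv (seqTail x) <| by
          obtain ⟨i, hi, hne⟩ := hx
          cases i with
          | zero => exact absurd hx0 hne
          | succ i => exact ⟨i, by omega, hne⟩
        exact ⟨by rw [consPerm_of_eq h hx0, h1, seqCons_seqTail hx0], h2.consPerm hx0⟩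
      · exact ⟨consPerm_of_ne h hx0, hasParity_consPerm_of_ne hx0⟩

end Bumps

section Separation

lemma infinite_agree (y : CantorC) (N : ℕ) : {x : CantorC | ∀ i < N, x i = y i}.Infinite := by
  refine Set.infinite_of_injective_forall_mem
    (f := fun k : ℕ => Function.update y (N + k) (!y (N + k))) (fun k l hkl => ?_) fun k i hi => ?_
  · by_contra hne
    have := congrFun hkl (N + k)
    simp [hne] at this
  · simp [show i ≠ N + k by omega]

lemma infinite_moved {g : Equiv.Perm CantorC} (hg : g ∈ FGrp) (h1 : g ≠ 1) :
    {x : CantorC | g x ≠ x}.Infinite := by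
  obtain ⟨y, hy⟩ : ∃ y, g y ≠ y := by
    by_contra! h
    exact h1 (Equiv.ext h)
  obtain ⟨i, hi⟩ := Function.ne_iff.1 hy
  obtain ⟨-, m, n, h, -⟩ := exists_hasParity_of_mem_FGrp hg y
  refine (infinite_agree y (n + (i + 1))).mono fun x hx hgx => hi ?_
  rw [← ((h.add (i + 1)) x hx).2 i (by omega), hgx, hx i (by omega)]

open Classical in
lemma exists_agree_avoid (Z : Finset CantorC) (z : CantorC) (hz : z ∉ Z) :
    ∃ N, ∀ x ∈ Z, ∃ i < N, x i ≠ z i := by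
  induction Z using Finset.induction_on with
  | empty => exact ⟨0, by simp⟩
  | insert a Z _ ih =>
    simp only [Finset.mem_insert, not_or] at hz
    obtain ⟨N, hN⟩ := ih hz.2
    obtain ⟨i, hi⟩ := Function.ne_iff.1 (Ne.symm hz.1)
    refine ⟨N + (i + 1), fun x hx => ?_⟩
    rcases Finset.mem_insert.1 hx with rfl | hx
    · exact ⟨i, by omega, hi⟩
    · obtain ⟨j, hj, hne⟩ := hN x hx
      exact ⟨j, by omega, hne⟩

lemma exists_flip_parity {f : Equiv.Perm CantorC} (hf : f ∈ FGrp) (Z : Finset CantorC)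
    {z : CantorC} (hz : z ∉ Z) {d : ZMod 2} (hd : HasParity f z d) :
    ∃ f' ∈ FGrp, HasParity f' z (d + 1) ∧
      ∀ x ∈ Z, ∀ e, HasParity f x e → HasParity f' x e := by
  obtain ⟨m, n, hmn, rfl⟩ := hd
  obtain ⟨N, hN⟩ := exists_agree_avoid Z z hz
  obtain ⟨h, hF, hodd, hfix, htriv⟩ := exists_bump (n + N) z
  refine ⟨f * h, mul_mem hf (Subgroup.subset_closure hF), ?_, fun x hx e he => ?_⟩
  · have hd : HasParity f (h z) (m + n) :=
      ⟨m, n, hmn.of_agree fun i hi => hfix i (by omega), rfl⟩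
    exact hd.comp hodd
  · obtain ⟨i, hi, hne⟩ := hN x hx
    obtain ⟨h1, h2⟩ := htriv x ⟨i, by omega, hne⟩
    rw [← h1] at he
    simpa using he.comp h2

open Classical in
lemma exists_simultaneous_odd (K : Finset (Equiv.Perm CantorC)) (hK : ∀ k ∈ K, k ∈ FGrp ∧ k ≠ 1) :
    ∃ f ∈ FGrp, ∃ Z : Finset CantorC, ∀ k ∈ K, ∃ y ∈ Z, k y ∈ Z ∧ ∃ a b c : ZMod 2,
      HasParity f (k y) a ∧ HasParity k y b ∧ HasParity f y c ∧ a + b + c = 1 := by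
  induction K using Finset.induction_on with
  | empty => exact ⟨1, one_mem _, ∅, by simp⟩
  | insert k K _ ih =>
    obtain ⟨f, hf, Z, hZ⟩ := ih fun k hk => hK k (Finset.mem_insert_of_mem hk)
    obtain ⟨hkF, hk1⟩ := hK k (Finset.mem_insert_self _ _)
    obtain ⟨y, hy, hyZ⟩ := (infinite_moved hkF hk1).exists_notMem_finset Z
    obtain ⟨a, ha⟩ := exists_hasParity_of_mem_FGrp hf (k y)
    obtain ⟨b, hb⟩ := exists_hasParity_of_mem_FGrp hkF y
    obtain ⟨c, hc⟩ := exists_hasParity_of_mem_FGrp hf y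
    obtain ⟨f', hf', c', hc', habc, hagree⟩ : ∃ f' ∈ FGrp, ∃ c', HasParity f' y c' ∧
        a + b + c' = 1 ∧ ∀ x ∈ insert (k y) Z, ∀ e, HasParity f x e → HasParity f' x e := by
      by_cases h : a + b + c = 1
      · exact ⟨f, hf, c, hc, h, fun _ _ _ => id⟩
      · obtain ⟨f', hf', hc', hagree⟩ := exists_flip_parity hf (insert (k y) Z) (z := y)
          (by simpa [hyZ] using Ne.symm hy) hc
        refine ⟨f', hf', c + 1, hc', ?_, hagree⟩
        have h2 : ∀ s t : ZMod 2, s + t ≠ 1 → s + (t + 1) = 1 := by decide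
        exact h2 _ _ h
    refine ⟨f', hf', insert y (insert (k y) Z), fun l hl => ?_⟩
    rcases Finset.mem_insert.1 hl with rfl | hl
    · exact ⟨y, by simp, by simp, a, b, c', hagree _ (by simp) _ ha, hb, hc', habc⟩
    · obtain ⟨x, hx, hlx, a, b, c, ha, hb, hc, h⟩ := hZ l hl
      exact ⟨x, by simp [hx], by simp [hlx], a, b, c, hagree _ (by simp [hlx]) _ ha, hb,
        hagree _ (by simp [hx]) _ hc, h⟩

open Classical in
lemma exists_conj_notMem_H2Sub (K : Finset FGrp) (hK : ∀ k ∈ K, k ≠ 1) :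
    ∃ f : FGrp, ∀ k ∈ K, f * k * f⁻¹ ∉ H2Sub := by
  obtain ⟨f, hf, Z, h⟩ := exists_simultaneous_odd (K.image Subtype.val) fun k hk => by
    obtain ⟨l, hl, rfl⟩ := Finset.mem_image.1 hk
    exact ⟨l.2, fun h => hK l hl (Subtype.ext h)⟩
  refine ⟨⟨f, hf⟩, fun k hk hmem => ?_⟩
  obtain ⟨y, -, -, a, b, c, ha, hb, hc, habc⟩ := h k (Finset.mem_image_of_mem _ hk)
  have hconj : HasParity ((f * k * f⁻¹ : Equiv.Perm CantorC)) (f y) (a + b + c) := by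
    have h1 := hc.symm
    rw [← Equiv.symm_apply_apply f y] at ha hb
    exact (HasParity.comp ha hb).comp h1
  have := hconj.unique (hasParity_zero_of_mem_H2Sub hmem (f y))
  rw [habc] at this
  exact one_ne_zero this

end Separation

/-- If any finite set of nontrivial elements has a common conjugate avoiding `H`, then the
permutation representation on `G ⧸ H` is faithful on the group algebra. -/
lemma injective_asAlgebraHom_ofMulAction_quotient {k G : Type*} [CommRing k] [Group G]
    (H : Subgroup G)
    (hH : ∀ K : Finset G, (∀ g ∈ K, g ≠ 1) → ∃ f : G, ∀ g ∈ K, f * g * f⁻¹ ∉ H) :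
    Function.Injective (Representation.ofMulAction k G (G ⧸ H)).asAlgebraHom := by
  classical
  rw [injective_iff_map_eq_zero]
  intro a ha
  ext g
  by_contra hg
  obtain ⟨f, hf⟩ := hH ((a.coeff.support.image fun s => g⁻¹ * s).erase 1)
    fun s hs => (Finset.mem_erase.1 hs).1
  have h1 : ((Representation.ofMulAction k G (G ⧸ H)).asAlgebraHom a
      (MonoidAlgebra.single ((f⁻¹ : G) : G ⧸ H) 1)).coeff ((g * f⁻¹ : G) : G ⧸ H) = 0 := by
    simp [ha]
  rw [Representation.asAlgebraHom_def, MonoidAlgebra.lift_apply, Finsupp.sum, LinearMap.sum_apply,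
    MonoidAlgebra.coeff_sum, Finsupp.finsetSum_apply, Finset.sum_eq_single g] at h1
  · refine hg ?_
    simpa using h1
  · intro s hs hne
    have hcoset : ((s * f⁻¹ : G) : G ⧸ H) ≠ ((g * f⁻¹ : G) : G ⧸ H) := by
      intro heq
      refine hf (g⁻¹ * s) (Finset.mem_erase.2 ⟨?_, Finset.mem_image_of_mem _ hs⟩) ?_
      · rwa [Ne, inv_mul_eq_one, eq_comm]
      · simpa [mul_assoc] using QuotientGroup.eq.1 heq.symm
    simp [hcoset]
  · intro hs
    simp [Finsupp.notMem_support_iff.1 hs]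

/-- the representation of the group algebra `ℂ[F]` on the finitely
supported functions on `F/H₂` induced by left translation is injective. -/
theorem stmt9 :
    Function.Injective
      (Representation.ofMulAction ℂ FGrp (FGrp ⧸ H2Sub)).asAlgebraHom := by
  exact injective_asAlgebraHom_ofMulAction_quotient H2Sub exists_conj_notMem_H2Sub
end

section
/- For every element f of Thompson's group F, there exist m, k ∈ ℕ with 0 < k ≤ 2^(2m+1) and 3 dividing k − 2, such that μ(p_f) = k / 2^(2m+1). (Forward direction of the characterization of Ω₂.) -/
open Set MeasureTheory Filter Topology

theorem wordApp_append (a u : BWord) (y : CantorC) :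
    wordApp (a ++ u) y = wordApp a (wordApp u y) := by
  funext n
  simp only [wordApp, List.length_append, List.get_eq_getElem]
  split_ifs <;> grind

theorem mem_cyl_iff (w : BWord) (x : CantorC) :
    x ∈ cyl w ↔ ∀ n : Fin w.length, x n = w.get n := by
  constructor
  · rintro ⟨y, rfl⟩ n
    simp [wordApp]
  · intro h
    refine ⟨fun n => x (n + w.length), ?_⟩
    funext n
    by_cases hn : n < w.length
    · simp [wordApp, hn, h ⟨n, hn⟩]
    · simp [wordApp, hn, Nat.sub_add_cancel (not_lt.mp hn)]

theorem measurableSet_cyl (w : BWord) : MeasurableSet (cyl w) := by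
  have : cyl w = ⋂ n : Fin w.length, (fun x : CantorC => x n) ⁻¹' {w.get n} := by
    ext x
    simp [mem_cyl_iff]
  rw [this]
  exact MeasurableSet.iInter fun n => measurable_pi_apply _ (measurableSet_singleton _)

/-- Of two words with meeting cylinders, the shorter is a prefix of the longer. -/
theorem prefix_of_mem_cyl {a b : BWord} {x : CantorC} (ha : x ∈ cyl a) (hb : x ∈ cyl b)
    (h : a.length ≤ b.length) : ∃ u, b = a ++ u := by
  rw [mem_cyl_iff] at ha hb
  have hab : a <+: b := by
    rw [List.prefix_iff_getElem]
    refine ⟨h, fun i hi => ?_⟩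
    have h₁ := ha ⟨i, hi⟩
    have h₂ := hb ⟨i, hi.trans_le h⟩
    simp only [List.get_eq_getElem] at h₁ h₂
    rw [← h₁, ← h₂]
  obtain ⟨u, hu⟩ := hab
  exact ⟨u, hu.symm⟩

section CylinderMeasure

variable {μ : Measure CantorC}

theorem length_eq_of_cyl_eq (hμ : ∀ w : BWord, μ (cyl w) = (2 : ENNReal)⁻¹ ^ w.length)
    {a b : BWord} (h : cyl a = cyl b) : a.length = b.length := by
  have h₁ := hμ a
  rw [h, hμ b, ← ENNReal.inv_pow, ← ENNReal.inv_pow, inv_inj] at h₁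
  have h₂ : (2 : ℕ) ^ b.length = 2 ^ a.length := by exact_mod_cast h₁
  exact (Nat.pow_right_injective le_rfl h₂).symm

/-- Two pairs inducing the same bijection and meeting on the left have the same
length difference. -/
theorem length_add_length_eq_of_mem_cyl (hμ : ∀ w : BWord, μ (cyl w) = (2 : ENNReal)⁻¹ ^ w.length)
    {g : Equiv.Perm CantorC} {p q : BWord × BWord} {x : CantorC}
    (hp : ∀ x, g (wordApp p.2 x) = wordApp p.1 x) (hq : ∀ x, g (wordApp q.2 x) = wordApp q.1 x)
    (hxp : x ∈ cyl p.1) (hxq : x ∈ cyl q.1) :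
    p.1.length + q.2.length = q.1.length + p.2.length := by
  wlog h : p.1.length ≤ q.1.length generalizing p q
  · exact (this hq hp hxq hxp (le_of_not_ge h)).symm
  obtain ⟨u, hu⟩ := prefix_of_mem_cyl hxp hxq h
  have key : wordApp q.2 = wordApp (p.2 ++ u) := by
    funext y
    apply g.injective
    rw [hq, hu, wordApp_append, wordApp_append, hp]
  have hl := length_eq_of_cyl_eq hμ (congrArg Set.range key : cyl q.2 = cyl (p.2 ++ u))
  rw [hl, hu]
  simp only [List.length_append]
  omega

theorem pF_eq_pSet (hμ : ∀ w : BWord, μ (cyl w) = (2 : ENNReal)⁻¹ ^ w.length)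
    {g : Equiv.Perm CantorC} {J : Finset (BWord × BWord)} (hJ : IsCodeFor J g) :
    pF g = pSet J := by
  refine Set.Subset.antisymm (Set.iUnion₂_subset ?_) (Set.subset_iUnion₂_of_subset J hJ subset_rfl)
  rintro J' hJ' x ⟨q, hqJ, hq, hxq⟩
  obtain ⟨p, ⟨hpJ, hxp⟩, -⟩ := hJ.1.1 x
  have := length_add_length_eq_of_mem_cyl hμ (hJ.2.2 p hpJ) (hJ'.2.2 q hqJ) hxp hxq
  refine ⟨p, hpJ, ?_, hxp⟩
  unfold EvenPair at *
  omega

theorem measure_biUnion_cyl (hμ : ∀ w : BWord, μ (cyl w) = (2 : ENNReal)⁻¹ ^ w.length)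
    {ι : Type*} (S : Finset ι) (w : ι → BWord)
    (hd : (S : Set ι).PairwiseDisjoint fun i => cyl (w i)) (M : ℕ)
    (hM : ∀ i ∈ S, (w i).length ≤ M) :
    μ (⋃ i ∈ S, cyl (w i)) = ((∑ i ∈ S, 2 ^ (M - (w i).length) : ℕ) : ENNReal) / 2 ^ M := by
  rw [measure_biUnion_finset hd fun i _ => measurableSet_cyl _, Nat.cast_sum, div_eq_mul_inv,
    Finset.sum_mul]
  refine Finset.sum_congr rfl fun i hi => ?_
  obtain ⟨d, rfl⟩ := Nat.exists_eq_add_of_le (hM i hi)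
  rw [hμ, Nat.add_sub_cancel_left, Nat.cast_pow, Nat.cast_ofNat, ENNReal.inv_pow, pow_add,
    mul_left_comm, ← mul_pow, ENNReal.mul_inv_cancel two_ne_zero ENNReal.ofNat_ne_top, one_pow,
    mul_one]

theorem ENNReal.natCast_div_two_pow_le_one {k M : ℕ} :
    (k : ENNReal) / 2 ^ M ≤ 1 ↔ k ≤ 2 ^ M := by
  rw [ENNReal.div_le_iff (by simp) (by simp), one_mul]
  exact_mod_cast Iff.rfl

theorem ENNReal.natCast_div_two_pow_eq_one {k M : ℕ} :
    (k : ENNReal) / 2 ^ M = 1 ↔ k = 2 ^ M := by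
  rw [ENNReal.div_eq_one_iff (by simp) (by simp)]
  exact_mod_cast Iff.rfl

theorem cyl_nil : cyl [] = Set.univ := by
  ext x
  simp [mem_cyl_iff]

theorem measure_univ_eq_one (hμ : ∀ w : BWord, μ (cyl w) = (2 : ENNReal)⁻¹ ^ w.length) :
    μ Set.univ = 1 := by
  simpa [cyl_nil] using hμ []

theorem pairwiseDisjoint_cyl {ι : Type*} {S : Finset ι} {w : ι → BWord}
    (h : ∀ x : CantorC, ∃! i, i ∈ S ∧ x ∈ cyl (w i)) :
    (S : Set ι).PairwiseDisjoint fun i => cyl (w i) := by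
  intro i hi j hj hij
  refine Set.disjoint_left.mpr fun x hx hx' => hij ?_
  exact (h x).unique ⟨hi, hx⟩ ⟨hj, hx'⟩

theorem two_pow_sub_zmod_three {M l : ℕ} (h : l ≤ M) :
    (2 : ZMod 3) ^ (M - l) = 2 ^ M * 2 ^ l := by
  obtain ⟨d, rfl⟩ := Nat.exists_eq_add_of_le h
  have h4 : (2 : ZMod 3) ^ l * 2 ^ l = 1 := by
    rw [← mul_pow, show (2 : ZMod 3) * 2 = 1 by decide, one_pow]
  rw [Nat.add_sub_cancel_left, pow_add]
  linear_combination -(2 : ZMod 3) ^ d * h4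

theorem sum_two_pow_length_zmod_three
    (hμ : ∀ w : BWord, μ (cyl w) = (2 : ENNReal)⁻¹ ^ w.length)
    {ι : Type*} {S : Finset ι} {w : ι → BWord}
    (h : ∀ x : CantorC, ∃! i, i ∈ S ∧ x ∈ cyl (w i)) :
    ∑ i ∈ S, (2 : ZMod 3) ^ (w i).length = 1 := by
  set M := ∑ i ∈ S, (w i).length
  have hM : ∀ i ∈ S, (w i).length ≤ M := fun i hi =>
    Finset.single_le_sum (f := fun i => (w i).length) (fun _ _ => Nat.zero_le _) hi
  have h₁ := measure_biUnion_cyl hμ S w (pairwiseDisjoint_cyl h) M hM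
  have hU : ⋃ i ∈ S, cyl (w i) = Set.univ := by
    refine Set.eq_univ_of_forall fun x => ?_
    obtain ⟨i, hi, -⟩ := h x
    exact Set.mem_biUnion hi.1 hi.2
  rw [hU, measure_univ_eq_one hμ, eq_comm, ENNReal.natCast_div_two_pow_eq_one] at h₁
  have h₂ := congrArg (Nat.cast : ℕ → ZMod 3) h₁
  push_cast at h₂
  rw [Finset.sum_congr rfl fun i hi => two_pow_sub_zmod_three (hM i hi), ← Finset.mul_sum] at h₂
  have hne : (2 : ZMod 3) ^ M * 2 ^ M = 1 := by
    rw [← mul_pow, show (2 : ZMod 3) * 2 = 1 by decide, one_pow]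
  linear_combination (2 : ZMod 3) ^ M * h₂ + (1 - ∑ i ∈ S, (2 : ZMod 3) ^ (w i).length) * hne

theorem two_pow_add_two_pow_zmod_three (a b : ℕ) :
    (2 : ZMod 3) ^ a + 2 ^ b = if a % 2 = b % 2 then 2 * 2 ^ a else 0 := by
  have h (n : ℕ) : (2 : ZMod 3) ^ n = 2 ^ (n % 2) := by
    conv_lhs => rw [← Nat.div_add_mod n 2, pow_add, pow_mul,
      show (2 : ZMod 3) ^ 2 = 1 by decide, one_pow, one_mul]
  rw [h a, h b]
  rcases Nat.mod_two_eq_zero_or_one a with ha | ha <;>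
    rcases Nat.mod_two_eq_zero_or_one b with hb | hb <;> rw [ha, hb] <;> decide

open Classical in
theorem sum_two_pow_length_evenPair
    (hμ : ∀ w : BWord, μ (cyl w) = (2 : ENNReal)⁻¹ ^ w.length)
    {J : Finset (BWord × BWord)} (hJ : IsCode J) :
    ∑ p ∈ J with EvenPair p, (2 : ZMod 3) ^ p.1.length = 1 := by
  have h₁ := sum_two_pow_length_zmod_three hμ hJ.1
  have h₂ := sum_two_pow_length_zmod_three hμ hJ.2
  have h₃ : ∑ p ∈ J with EvenPair p, 2 * (2 : ZMod 3) ^ p.1.length = 1 + 1 := by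
    nth_rewrite 1 [← h₁]
    rw [← h₂, ← Finset.sum_add_distrib, Finset.sum_filter]
    refine Finset.sum_congr rfl fun p _ => ?_
    rw [two_pow_add_two_pow_zmod_three]
    simp only [EvenPair]
    congr
  rw [← Finset.mul_sum] at h₃
  generalize ∑ p ∈ J with EvenPair p, (2 : ZMod 3) ^ p.1.length = s at h₃
  revert s
  decide

end CylinderMeasure

/-- for every `f ∈ F`, `μ(p_f) = k / 2^(2m+1)` with `0 < k ≤ 2^(2m+1)`
and `3 ∣ k − 2`, where `μ` is the uniform Bernoulli measure (characterized by
`μ(C_w) = 2^(−|w|)`). -/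
theorem stmt10 (μ : Measure CantorC)
    (hμ : ∀ w : BWord, μ (cyl w) = (2 : ENNReal)⁻¹ ^ w.length)
    (f : Equiv.Perm CantorC) (hf : InF f) :
    ∃ m k : ℕ, 0 < k ∧ k ≤ 2 ^ (2 * m + 1) ∧ (3 : ℤ) ∣ (k : ℤ) - 2 ∧
      μ (pF f) = (k : ENNReal) / 2 ^ (2 * m + 1) := by
  classical
  obtain ⟨J, hJ⟩ := hf
  set m := ∑ p ∈ J, p.1.length
  set S := J.filter EvenPair
  have hM : ∀ p ∈ J, p.1.length ≤ 2 * m + 1 := fun p hp => by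
    have : p.1.length ≤ m := Finset.single_le_sum (f := fun p : BWord × BWord => p.1.length)
      (fun _ _ => Nat.zero_le _) hp
    omega
  have hMS : ∀ p ∈ S, p.1.length ≤ 2 * m + 1 := fun p hp => hM p (Finset.mem_filter.mp hp).1
  have hU : pF f = ⋃ p ∈ S, cyl p.1 := by
    rw [pF_eq_pSet hμ hJ]
    ext x
    simp [pSet, S, and_assoc]
  have hd : (S : Set (BWord × BWord)).PairwiseDisjoint fun p => cyl p.1 :=
    (pairwiseDisjoint_cyl hJ.1.1).subset (Finset.coe_subset.mpr (Finset.filter_subset _ _))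
  have hk := measure_biUnion_cyl hμ S Prod.fst hd (2 * m + 1) hMS
  rw [← hU] at hk
  set k := ∑ p ∈ S, 2 ^ (2 * m + 1 - p.1.length)
  have hk3 : (k : ZMod 3) = 2 := by
    simp only [k, Nat.cast_sum, Nat.cast_pow, Nat.cast_ofNat]
    rw [Finset.sum_congr rfl fun p hp => two_pow_sub_zmod_three (hMS p hp), ← Finset.mul_sum,
      sum_two_pow_length_evenPair hμ hJ.1, mul_one, pow_succ, pow_mul,
      show (2 : ZMod 3) ^ 2 = 1 by decide, one_pow, one_mul]
  have hdvd : (3 : ℤ) ∣ (k : ℤ) - 2 := by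
    rw [← Nat.cast_ofNat, ← ZMod.intCast_zmod_eq_zero_iff_dvd]
    push_cast
    rw [hk3, sub_self]
  refine ⟨m, k, by omega, ?_, hdvd, hk⟩
  rw [← ENNReal.natCast_div_two_pow_le_one, ← hk, ← measure_univ_eq_one hμ]
  exact measure_mono (Set.subset_univ _)
end

section
/- For each f in Thompson's group F there exists a unique homeomorphism Φ_f of the compact space Ω̄₂ such that Φ_f(T(q), T(C ∖ q)) = (T(f · q), T(C ∖ (f · q))) for every q ∈ Ω₂; moreover Φ_{f∘g} = Φ_f ∘ Φ_g for all f, g ∈ F and Φ_{id} = id, so f ↦ Φ_f is an action of F on Ω̄₂ by homeomorphisms extending the action on Ω₂. -/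
open Set MeasureTheory Filter Topology

@[simp] lemma wordApp_cons_zero (c : Bool) (w : BWord) (x : CantorC) :
    wordApp (c :: w) x 0 = c := by
  simp [wordApp]

@[simp] lemma wordApp_cons_succ (c : Bool) (w : BWord) (x : CantorC) (n : ℕ) :
    wordApp (c :: w) x (n + 1) = wordApp w x n := by
  simp [wordApp]

lemma wordApp_cons_eq_iff {c d : Bool} {v w : BWord} {x y : CantorC} :
    wordApp (c :: v) x = wordApp (d :: w) y ↔ c = d ∧ wordApp v x = wordApp w y := by
  constructor
  · intro h
    exact ⟨by simpa using congrFun h 0, funext fun n => by simpa using congrFun h (n + 1)⟩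
  · rintro ⟨rfl, h⟩
    funext n
    cases n with
    | zero => simp
    | succ n => simpa using congrFun h n

lemma wordApp_append_s14 (v w : BWord) (x : CantorC) :
    wordApp (v ++ w) x = wordApp v (wordApp w x) := by
  induction v with
  | nil => simp
  | cons c v ih => exact wordApp_cons_eq_iff.2 ⟨rfl, ih⟩

lemma wordApp_injective (w : BWord) : Function.Injective (wordApp w) := by
  induction w with
  | nil => intro x y h; simpa using h
  | cons c w ih => exact fun x y h => ih (wordApp_cons_eq_iff.1 h).2

lemma exists_wordApp_eq (N : ℕ) (x : CantorC) :
    ∃ w : BWord, ∃ y, w.length = N ∧ wordApp w y = x := by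
  induction N generalizing x with
  | zero => exact ⟨[], x, rfl, wordApp_nil x⟩
  | succ N ih =>
    obtain ⟨w, y, hw, hy⟩ := ih fun n => x (n + 1)
    refine ⟨x 0 :: w, y, by simp [hw], funext fun n => ?_⟩
    cases n with
    | zero => simp
    | succ n => simpa using congrFun hy n

lemma exists_append_of_wordApp_eq {v w : BWord} {x y : CantorC} (h : wordApp v x = wordApp w y)
    (hl : v.length ≤ w.length) : ∃ u, w = v ++ u ∧ x = wordApp u y := by
  induction v generalizing w with
  | nil => exact ⟨w, rfl, by simpa using h⟩
  | cons c v ih =>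
    cases w with
    | nil => simp at hl
    | cons d w =>
      obtain ⟨rfl, hvw⟩ := wordApp_cons_eq_iff.1 h
      obtain ⟨u, rfl, hu⟩ := ih hvw (by simpa using hl)
      exact ⟨u, rfl, hu⟩

lemma length_eq_of_wordApp_eq {v w : BWord} (h : ∀ x, wordApp v x = wordApp w x) :
    v.length = w.length := by
  wlog hl : v.length ≤ w.length generalizing v w
  · exact (this (fun x => (h x).symm) (by omega)).symm
  obtain ⟨u, rfl, -⟩ := exists_append_of_wordApp_eq (h fun _ => false) hl
  cases u with
  | nil => simp
  | cons d u =>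
    have := h fun _ => !d
    rw [wordApp_append_s14] at this
    simpa using congrFun (wordApp_injective v this) 0

/-! ### The lexicographic order on the Cantor space -/

/-- The strict lexicographic order on the Cantor space. -/
def LexLt (x y : CantorC) : Prop :=
  ∃ n, (∀ m < n, x m = y m) ∧ x n = false ∧ y n = true

lemma LexLt.asymm {x y : CantorC} (h : LexLt x y) : ¬ LexLt y x := by
  rintro ⟨m, hm, hm0, hm1⟩
  obtain ⟨n, hn, hn0, hn1⟩ := h
  rcases lt_trichotomy m n with hlt | rfl | hlt
  · have := hn m hlt; simp_all
  · simp_all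
  · have := hm n hlt; simp_all

lemma lexLt_or_lexLt {x y : CantorC} (h : x ≠ y) : LexLt x y ∨ LexLt y x := by
  classical
  have hex : ∃ n, x n ≠ y n := Function.ne_iff.1 h
  have hmin : ∀ m < Nat.find hex, x m = y m := fun m hm => not_not.1 (Nat.find_min hex hm)
  have hne := Nat.find_spec hex
  cases hx : x (Nat.find hex) <;> cases hy : y (Nat.find hex)
  · exact absurd (hx.trans hy.symm) hne
  · exact .inl ⟨_, hmin, hx, hy⟩
  · exact .inr ⟨_, fun m hm => (hmin m hm).symm, hy, hx⟩
  · exact absurd (hx.trans hy.symm) hne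

lemma lexLt_wordApp_cons {c d : Bool} {v w : BWord} {x y : CantorC} :
    LexLt (wordApp (c :: v) x) (wordApp (d :: w) y) ↔
      (c = false ∧ d = true) ∨ (c = d ∧ LexLt (wordApp v x) (wordApp w y)) := by
  constructor
  · rintro ⟨n, hn, h0, h1⟩
    cases n with
    | zero => exact .inl ⟨by simpa using h0, by simpa using h1⟩
    | succ n =>
      refine .inr ⟨by simpa using hn 0 n.succ_pos, n, fun m hm => ?_, by simpa using h0,
        by simpa using h1⟩
      simpa using hn (m + 1) (by omega)
  · rintro (⟨rfl, rfl⟩ | ⟨rfl, n, hn, h0, h1⟩)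
    · exact ⟨0, by simp, by simp, by simp⟩
    · refine ⟨n + 1, fun m hm => ?_, by simpa using h0, by simpa using h1⟩
      cases m with
      | zero => simp
      | succ m => simpa using hn m (by omega)

lemma lexLt_wordApp_iff {w : BWord} {x y : CantorC} :
    LexLt (wordApp w x) (wordApp w y) ↔ LexLt x y := by
  induction w with
  | nil => simp
  | cons c w ih => rw [lexLt_wordApp_cons, ih]; cases c <;> simp

/-- On words with disjoint cylinders, the lexicographic orders on words and on points agree. -/
lemma lex_iff_lexLt {v w : BWord} (h : Disjoint (cyl v) (cyl w)) (x y : CantorC) :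
    List.Lex (· < ·) v w ↔ LexLt (wordApp v x) (wordApp w y) := by
  induction v generalizing w with
  | nil => exact absurd ⟨y, rfl⟩ (Set.disjoint_right.1 h · ⟨wordApp w y, by simp⟩)
  | cons c v ih =>
    cases w with
    | nil => exact absurd ⟨wordApp (c :: v) x, by simp⟩ (Set.disjoint_left.1 h ⟨x, rfl⟩)
    | cons d w =>
      rw [List.cons_lex_cons_iff, lexLt_wordApp_cons]
      by_cases hcd : c = d
      · subst hcd
        rw [ih]
        · cases c <;> simp
        · rw [Set.disjoint_left]
          rintro _ ⟨a, rfl⟩ ⟨b, hb⟩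
          exact Set.disjoint_left.1 h ⟨a, rfl⟩ ⟨b, wordApp_cons_eq_iff.2 ⟨rfl, hb⟩⟩
      · cases c <;> cases d <;> simp_all

/-! ### Local word replacement -/

/-- The bijection `f` replaces the prefix `β` by `α`. -/
def Replaces (f : Equiv.Perm CantorC) (β α : BWord) : Prop :=
  ∀ x, f (wordApp β x) = wordApp α x

section Replaces

variable {f g : Equiv.Perm CantorC} {α β γ α' β' : BWord}

lemma Replaces.append (h : Replaces f β α) (γ : BWord) : Replaces f (β ++ γ) (α ++ γ) := by
  intro x
  rw [wordApp_append_s14, wordApp_append_s14, h]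

lemma Replaces.mul (hf : Replaces f γ α) (hg : Replaces g β γ) : Replaces (f * g) β α := by
  intro x
  rw [Equiv.Perm.mul_apply, hg, hf]

lemma Replaces.symm (h : Replaces f β α) : Replaces f⁻¹ α β := by
  intro x
  rw [← h x]
  exact f.symm_apply_apply _

lemma Replaces.mem_cyl_iff (h : Replaces f β α) {x : CantorC} : x ∈ cyl α ↔ f⁻¹ x ∈ cyl β := by
  constructor
  · rintro ⟨y, rfl⟩
    exact ⟨y, (h.symm y).symm⟩
  · rintro ⟨y, hy⟩
    exact ⟨y, by rw [← h y, hy]; exact f.apply_symm_apply x⟩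

lemma Replaces.length_add_length (h : Replaces f β α) (h' : Replaces f β' α') {x y : CantorC}
    (hxy : wordApp β x = wordApp β' y) : α.length + β'.length = α'.length + β.length := by
  wlog hl : β.length ≤ β'.length generalizing α β α' β' x y
  · have := this h' h hxy.symm (by omega)
    omega
  obtain ⟨u, rfl, -⟩ := exists_append_of_wordApp_eq hxy hl
  have := length_eq_of_wordApp_eq fun z => (h.append u z).symm.trans (h' z)
  simp only [List.length_append] at this ⊢
  omega

end Replaces

/-! ### Thompson's group -/

section InF

variable {f g : Equiv.Perm CantorC}

lemma IsCode.disjoint_fst {J : Finset (BWord × BWord)} (hJ : IsCode J) {p q : BWord × BWord}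
    (hp : p ∈ J) (hq : q ∈ J) (hpq : p ≠ q) : Disjoint (cyl p.1) (cyl q.1) :=
  Set.disjoint_left.2 fun x hxp hxq => hpq ((hJ.1 x).unique ⟨hp, hxp⟩ ⟨hq, hxq⟩)

lemma IsCode.disjoint_snd {J : Finset (BWord × BWord)} (hJ : IsCode J) {p q : BWord × BWord}
    (hp : p ∈ J) (hq : q ∈ J) (hpq : p ≠ q) : Disjoint (cyl p.2) (cyl q.2) :=
  Set.disjoint_left.2 fun x hxp hxq => hpq ((hJ.2 x).unique ⟨hp, hxp⟩ ⟨hq, hxq⟩)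

lemma InF.exists_replaces (hf : InF f) : ∃ N, ∀ w : BWord, N ≤ w.length → ∃ α, Replaces f w α := by
  obtain ⟨J, hJ, -, hfJ⟩ := hf
  refine ⟨J.sup fun p => p.2.length, fun w hw => ?_⟩
  obtain ⟨p, ⟨hp, y, hy⟩, -⟩ := hJ.2 (wordApp w fun _ => false)
  have hle : p.2.length ≤ w.length := (Finset.le_sup (f := fun p => p.2.length) hp).trans hw
  obtain ⟨u, rfl, -⟩ := exists_append_of_wordApp_eq hy hle
  have hr : Replaces f p.2 p.1 := hfJ p hp
  exact ⟨p.1 ++ u, hr.append u⟩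

lemma InF.lexLt (hf : InF f) {x y : CantorC} (h : LexLt x y) : LexLt (f x) (f y) := by
  obtain ⟨J, hJ, hord, hfJ⟩ := hf
  obtain ⟨p, ⟨hp, x, rfl⟩, -⟩ := hJ.2 x
  obtain ⟨q, ⟨hq, y, rfl⟩, -⟩ := hJ.2 y
  rw [hfJ p hp, hfJ q hq]
  by_cases hpq : p = q
  · subst hpq
    rwa [lexLt_wordApp_iff] at h ⊢
  · rwa [← lex_iff_lexLt (hJ.disjoint_fst hp hq hpq), hord p hp q hq,
      lex_iff_lexLt (hJ.disjoint_snd hp hq hpq) x y]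

/-- Monotone bijections that are locally given by word replacement lie in Thompson's group. -/
lemma inF_of_lexLt (N : ℕ) (hN : ∀ w : BWord, w.length = N → ∃ α, Replaces f w α)
    (hmono : ∀ x y, LexLt x y → LexLt (f x) (f y)) : InF f := by
  classical
  choose! A hA using hN
  set J : Finset (BWord × BWord) :=
    (List.finite_length_eq Bool N).toFinset.image fun w => (A w, w) with hJdef
  have hmem : ∀ {p}, p ∈ J ↔ p.2.length = N ∧ p.1 = A p.2 := by
    rintro ⟨a, b⟩
    simp only [hJdef, Finset.mem_image, Set.Finite.mem_toFinset, Set.mem_ofPred_eq, Prod.mk.injEq]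
    constructor
    · rintro ⟨w, hw, rfl, rfl⟩
      exact ⟨hw, rfl⟩
    · rintro ⟨hb, ha⟩
      exact ⟨b, hb, ha.symm, rfl⟩
  have hrep : ∀ p ∈ J, Replaces f p.2 p.1 := fun p hp => by
    rw [(hmem.1 hp).2]
    exact hA _ (hmem.1 hp).1
  have hsnd : ∀ x : CantorC, ∃! p : BWord × BWord, p ∈ J ∧ x ∈ cyl p.2 := by
    intro x
    obtain ⟨w, y, hw, rfl⟩ := exists_wordApp_eq N x
    refine ⟨(A w, w), ⟨hmem.2 ⟨hw, rfl⟩, y, rfl⟩, ?_⟩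
    rintro ⟨a, b⟩ ⟨hp, z, hz⟩
    obtain ⟨hb, ha⟩ := hmem.1 hp
    dsimp only at hb ha hz
    subst ha
    obtain ⟨u, rfl, -⟩ := exists_append_of_wordApp_eq hz (by omega)
    have : u = [] := by
      rw [← List.length_eq_zero_iff]
      rw [List.length_append] at hw
      omega
    simp [this]
  have hcode : IsCode J := by
    refine ⟨fun x => ?_, hsnd⟩
    obtain ⟨p, ⟨hp, hx⟩, huniq⟩ := hsnd (f⁻¹ x)
    exact ⟨p, ⟨hp, (hrep p hp).mem_cyl_iff.2 hx⟩,
      fun q hq => huniq q ⟨hq.1, (hrep q hq.1).mem_cyl_iff.1 hq.2⟩⟩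
  refine ⟨J, hcode, fun p hp q hq => ?_, hrep⟩
  by_cases hpq : p = q
  · subst hpq
    have hirr : ∀ w : BWord, ¬ List.Lex (· < ·) w w := fun w => List.lex_irrefl (by simp) w
    exact iff_of_false (hirr _) (hirr _)
  · let z : CantorC := fun _ => false
    have hdis := hcode.disjoint_snd hp hq hpq
    rw [lex_iff_lexLt (hcode.disjoint_fst hp hq hpq) z z, lex_iff_lexLt hdis z z,
      ← hrep p hp, ← hrep q hq]
    refine ⟨fun h => ?_, hmono _ _⟩
    have hne : wordApp p.2 z ≠ wordApp q.2 z := fun h =>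
      Set.disjoint_left.1 hdis ⟨z, rfl⟩ ⟨z, h.symm⟩
    exact (lexLt_or_lexLt hne).resolve_right fun h' => h.asymm (hmono _ _ h')

lemma InF.exists_replaces_replaces (hf : InF f) (hg : InF g) :
    ∃ N, ∀ w : BWord, w.length = N → ∃ γ α, Replaces g w γ ∧ Replaces f γ α := by
  obtain ⟨M, hM⟩ := hf.exists_replaces
  obtain ⟨N, hN⟩ := hg.exists_replaces
  refine ⟨N + M, fun w hw => ?_⟩
  obtain ⟨γ, hγ⟩ := hN (w.take N) (by simp; omega)
  obtain ⟨α, hα⟩ := hM (γ ++ w.drop N) (by simp; omega)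
  refine ⟨_, α, ?_, hα⟩
  simpa using hγ.append (w.drop N)

lemma InF.mul (hf : InF f) (hg : InF g) : InF (f * g) := by
  obtain ⟨N, hN⟩ := hf.exists_replaces_replaces hg
  refine inF_of_lexLt N (fun w hw => ?_) fun x y h => hf.lexLt (hg.lexLt h)
  obtain ⟨γ, α, hγ, hα⟩ := hN w hw
  exact ⟨α, hα.mul hγ⟩

lemma InF.inv (hf : InF f) : InF f⁻¹ := by
  obtain ⟨N, hN⟩ : ∃ N, ∀ w : BWord, N ≤ w.length → ∃ α, Replaces f⁻¹ w α := by
    obtain ⟨J, hJ, -, hfJ⟩ := hf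
    refine ⟨J.sup fun p => p.1.length, fun w hw => ?_⟩
    obtain ⟨p, ⟨hp, y, hy⟩, -⟩ := hJ.1 (wordApp w fun _ => false)
    have hle : p.1.length ≤ w.length := (Finset.le_sup (f := fun p => p.1.length) hp).trans hw
    obtain ⟨u, rfl, -⟩ := exists_append_of_wordApp_eq hy hle
    have hr : Replaces f p.2 p.1 := hfJ p hp
    exact ⟨p.2 ++ u, hr.symm.append u⟩
  refine inF_of_lexLt N (fun w hw => hN w hw.ge) fun x y h => ?_
  have hne : f⁻¹ x ≠ f⁻¹ y := fun he => by
    rw [f⁻¹.injective he] at h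
    exact h.asymm h
  refine (lexLt_or_lexLt hne).resolve_right fun h' => h.asymm ?_
  simpa using hf.lexLt h'

lemma replaces_one (w : BWord) : Replaces 1 w w := fun _ => rfl

lemma inF_one : InF 1 :=
  inF_of_lexLt 0 (fun w _ => ⟨w, replaces_one w⟩) fun _ _ h => h

/-! ### The parity cocycle and the action on subsets -/

lemma Replaces.wordApp_mem_EF {α β : BWord} (h : Replaces f β α) (hf : InF f) (x : CantorC) :
    wordApp β x ∈ EF f ↔ EvenPair (α, β) := by
  simp only [EF, eSet, Set.mem_iUnion, Set.mem_ofPred_eq, exists_prop]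
  constructor
  · rintro ⟨J, hJ, p, hp, hev, y, hy⟩
    have hr : Replaces f p.2 p.1 := hJ.2.2 p hp
    have := h.length_add_length hr hy.symm
    simp only [EvenPair] at hev ⊢
    omega
  · intro hev
    obtain ⟨J, hJ⟩ := hf
    obtain ⟨p, ⟨hp, y, hy⟩, -⟩ := hJ.1.2 (wordApp β x)
    refine ⟨J, hJ, p, hp, ?_, y, hy⟩
    have hr : Replaces f p.2 p.1 := hJ.2.2 p hp
    have := h.length_add_length hr hy.symm
    simp only [EvenPair] at hev ⊢
    omega

lemma mem_pF {x : CantorC} : x ∈ pF f ↔ f⁻¹ x ∈ EF f := by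
  simp only [pF, EF, pSet, eSet, Set.mem_iUnion, Set.mem_ofPred_eq, exists_prop]
  refine exists_congr fun J => and_congr_right fun hJ => exists_congr fun p =>
    and_congr_right fun hp => and_congr_right fun _ => ?_
  have hr : Replaces f p.2 p.1 := hJ.2.2 p hp
  exact hr.mem_cyl_iff

lemma InF.mem_EF_mul (hf : InF f) (hg : InF g) (x : CantorC) :
    x ∈ EF (f * g) ↔ (g x ∈ EF f ↔ x ∈ EF g) := by
  obtain ⟨N, hN⟩ := hf.exists_replaces_replaces hg
  obtain ⟨w, y, hw, rfl⟩ := exists_wordApp_eq N x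
  obtain ⟨γ, α, hγ, hα⟩ := hN w hw
  rw [(hα.mul hγ).wordApp_mem_EF (hf.mul hg), hγ.wordApp_mem_EF hg, hγ, hα.wordApp_mem_EF hf]
  simp only [EvenPair]
  omega

lemma mem_actF {p : Set CantorC} {x : CantorC} :
    x ∈ actF f p ↔ (f⁻¹ x ∈ p ↔ f⁻¹ x ∈ EF f) := by
  have himg : ∀ s : Set CantorC, x ∈ f '' s ↔ f⁻¹ x ∈ s := fun s => by
    rw [Equiv.image_eq_preimage_symm]; rfl
  simp only [actF, Set.mem_union, himg, Set.mem_inter_iff, Set.mem_compl_iff]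
  tauto

lemma compl_actF (p : Set CantorC) : (actF f p)ᶜ = actF f pᶜ := by
  ext x
  simp only [Set.mem_compl_iff, mem_actF]
  tauto

lemma InF.actF_mul (hf : InF f) (hg : InF g) (p : Set CantorC) :
    actF (f * g) p = actF f (actF g p) := by
  ext x
  have hgx : g (g⁻¹ (f⁻¹ x)) = f⁻¹ x := g.apply_symm_apply _
  simp only [mem_actF, hf.mem_EF_mul hg, mul_inv_rev, Equiv.Perm.mul_apply, hgx]
  tauto

lemma actF_one (p : Set CantorC) : actF 1 p = p := by
  ext x
  have h : x ∈ EF 1 := by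
    simpa [EvenPair] using ((replaces_one []).wordApp_mem_EF inF_one x).2 rfl
  rw [mem_actF]
  simp [h]

lemma InF.actF_mem_Omega2 (hf : InF f) {q : Set CantorC} (hq : q ∈ Omega2) :
    actF f q ∈ Omega2 := by
  obtain ⟨g, hg, rfl⟩ := hq
  refine ⟨f * g, hf.mul hg, ?_⟩
  ext x
  have hgx : g (g⁻¹ (f⁻¹ x)) = f⁻¹ x := g.apply_symm_apply _
  simp only [mem_actF, mem_pF, hf.mem_EF_mul hg, mul_inv_rev, Equiv.Perm.mul_apply, hgx]
  tauto

end InF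

/-! ### Extension to the closure -/

lemma Tb_eq_true {p : Set CantorC} {w : BWord} : Tb p w = true ↔ ∃ x, wordApp w x ∈ p := by
  have h : (cyl w ∩ p).Nonempty ↔ ∃ x, wordApp w x ∈ p := by
    simp [cyl, Set.inter_nonempty]
  rw [← h, Tb]
  split_ifs with hp <;> simp [hp]

lemma Tb_eq_or (p : Set CantorC) (w : BWord) :
    Tb p w = (Tb p (w ++ [false]) || Tb p (w ++ [true])) := by
  rw [Bool.eq_iff_iff, Bool.or_eq_true]
  simp only [Tb_eq_true, wordApp_append_s14]
  constructor
  · rintro ⟨x, hx⟩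
    obtain ⟨v, y, hv, rfl⟩ := exists_wordApp_eq 1 x
    obtain ⟨c, rfl⟩ := List.length_eq_one_iff.1 hv
    cases c
    · exact .inl ⟨y, hx⟩
    · exact .inr ⟨y, hx⟩
  · rintro (⟨x, hx⟩ | ⟨x, hx⟩) <;> exact ⟨_, hx⟩

lemma Replaces.Tb_actF {f : Equiv.Perm CantorC} {α β : BWord} (h : Replaces f β α) (hf : InF f)
    (p : Set CantorC) [Decidable (EvenPair (α, β))] :
    Tb (actF f p) α = if EvenPair (α, β) then Tb p β else Tb pᶜ β := by
  rw [Bool.eq_iff_iff]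
  split_ifs with hev <;>
    simp [Tb_eq_true, mem_actF, h.symm _, h.wordApp_mem_EF hf, hev]

lemma InF.exists_continuous_Tb {f : Equiv.Perm CantorC} (hf : InF f) (w : BWord) :
    ∃ h : (BWord → Bool) × (BWord → Bool) → Bool, Continuous h ∧
      ∀ q, h (embedT q) = Tb (actF f q) w := by
  classical
  obtain ⟨N, hN⟩ := hf.inv.exists_replaces
  induction hk : N - w.length generalizing w with
  | zero =>
    obtain ⟨β, hβ⟩ := hN w (by omega)
    have hr : Replaces f β w := by simpa using hβ.symm
    refine ⟨fun s => if EvenPair (w, β) then s.1 β else s.2 β, ?_, fun q => ?_⟩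
    · split_ifs <;> fun_prop
    · rw [hr.Tb_actF hf]
      rfl
  | succ k ih =>
    obtain ⟨h₀, hc₀, he₀⟩ := ih (w ++ [false]) (by simp; omega)
    obtain ⟨h₁, hc₁, he₁⟩ := ih (w ++ [true]) (by simp; omega)
    refine ⟨fun s => h₀ s || h₁ s, ?_, fun q => ?_⟩
    · exact (continuous_of_discreteTopology (f := fun b : Bool × Bool => b.1 || b.2)).comp
        (hc₀.prodMk hc₁)
    · rw [Tb_eq_or, ← he₀, ← he₁]

lemma InF.exists_continuous_extension {f : Equiv.Perm CantorC} (hf : InF f) :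
    ∃ H : (BWord → Bool) × (BWord → Bool) → (BWord → Bool) × (BWord → Bool), Continuous H ∧
      ∀ q, H (embedT q) = embedT (actF f q) := by
  choose h hc he using hf.exists_continuous_Tb
  refine ⟨fun s => (fun w => h w s, fun w => h w s.swap), ?_, fun q => ?_⟩
  · exact (continuous_pi hc).prodMk (continuous_pi fun w => (hc w).comp continuous_swap)
  · have hswap : (embedT q).swap = embedT qᶜ := by simp [embedT]
    refine Prod.ext (funext fun w => he w q) (funext fun w => ?_)
    change h w (embedT q).swap = Tb (actF f q)ᶜ w
    rw [hswap, he, compl_actF]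

/-- The embedding of `Omega2` into its closure. -/
noncomputable def toOmegaBar (q : Omega2) : OmegaBar :=
  ⟨embedT q, subset_closure (Set.mem_image_of_mem embedT q.2)⟩

lemma denseRange_toOmegaBar : DenseRange toOmegaBar := by
  rw [DenseRange, Subtype.dense_iff]
  refine closure_mono ?_
  rintro _ ⟨q, hq, rfl⟩
  exact ⟨toOmegaBar ⟨q, hq⟩, ⟨_, rfl⟩, rfl⟩

lemma InF.exists_continuous_OmegaBar {f : Equiv.Perm CantorC} (hf : InF f) :
    ∃ H : OmegaBar → OmegaBar, Continuous H ∧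
      ∀ q, H (toOmegaBar q) = toOmegaBar ⟨actF f q, hf.actF_mem_Omega2 q.2⟩ := by
  obtain ⟨H, hc, he⟩ := hf.exists_continuous_extension
  have hmaps : Set.MapsTo H OmegaBar OmegaBar := by
    refine Set.MapsTo.closure ?_ hc
    rintro _ ⟨q, hq, rfl⟩
    exact ⟨_, hf.actF_mem_Omega2 hq, (he q).symm⟩
  exact ⟨hmaps.restrict, hc.restrict hmaps, fun q => Subtype.ext (he q)⟩

lemma InF.exists_homeomorph {f : Equiv.Perm CantorC} (hf : InF f) :
    ∃ Φ : OmegaBar ≃ₜ OmegaBar,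
      ∀ q, Φ (toOmegaBar q) = toOmegaBar ⟨actF f q, hf.actF_mem_Omega2 q.2⟩ := by
  obtain ⟨H, hc, he⟩ := hf.exists_continuous_OmegaBar
  obtain ⟨K, hc', he'⟩ := hf.inv.exists_continuous_OmegaBar
  have hKH : K ∘ H = id := denseRange_toOmegaBar.equalizer (hc'.comp hc) continuous_id <| by
    funext q
    simp [he, he', ← hf.inv.actF_mul hf, actF_one]
  have hHK : H ∘ K = id := denseRange_toOmegaBar.equalizer (hc.comp hc') continuous_id <| by
    funext q
    simp [he, he', ← hf.actF_mul hf.inv, actF_one]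
  exact ⟨⟨⟨H, K, congrFun hKH, congrFun hHK⟩, hc, hc'⟩, he⟩

lemma homeomorph_OmegaBar_ext {Φ Ψ : OmegaBar ≃ₜ OmegaBar}
    (h : ∀ q, Φ (toOmegaBar q) = Ψ (toOmegaBar q)) : Φ = Ψ :=
  DFunLike.coe_injective
    (denseRange_toOmegaBar.equalizer Φ.continuous Ψ.continuous (funext h))

/-- for each `f ∈ F` there is a unique homeomorphism `Φ_f` of `Ω̄₂`
with `Φ_f(T(q), T(C∖q)) = (T(f·q), T(C∖(f·q)))` for all `q ∈ Ω₂`; moreover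
`Φ_{f∘g} = Φ_f ∘ Φ_g` and `Φ_id = id`, so `F` acts on `Ω̄₂` by homeomorphisms. -/
theorem stmt14 :
    ∃ Φ : Equiv.Perm CantorC → (↥OmegaBar ≃ₜ ↥OmegaBar),
      (∀ f : Equiv.Perm CantorC, InF f → ∀ q, ∀ hq : q ∈ Omega2,
        ((Φ f) ⟨embedT q, subset_closure (Set.mem_image_of_mem embedT hq)⟩ :
          (BWord → Bool) × (BWord → Bool)) = embedT (actF f q)) ∧
      (∀ f : Equiv.Perm CantorC, InF f → ∀ Ψ : ↥OmegaBar ≃ₜ ↥OmegaBar,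
        (∀ q, ∀ hq : q ∈ Omega2,
          (Ψ ⟨embedT q, subset_closure (Set.mem_image_of_mem embedT hq)⟩ :
            (BWord → Bool) × (BWord → Bool)) = embedT (actF f q)) → Ψ = Φ f) ∧
      (∀ f g : Equiv.Perm CantorC, InF f → InF g → Φ (f * g) = (Φ g).trans (Φ f)) ∧
      Φ (1 : Equiv.Perm CantorC) = Homeomorph.refl _ := by
  classical
  choose Φ hΦ using fun (f : Equiv.Perm CantorC) (hf : InF f) => hf.exists_homeomorph
  refine ⟨fun f => if hf : InF f then Φ f hf else Homeomorph.refl _, ?_, ?_, ?_, ?_⟩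
  · intro f hf q hq
    simp only [dif_pos hf]
    exact congrArg Subtype.val (hΦ f hf ⟨q, hq⟩)
  · intro f hf Ψ hΨ
    simp only [dif_pos hf]
    refine homeomorph_OmegaBar_ext fun q => ?_
    rw [hΦ]
    exact Subtype.ext (hΨ q q.2)
  · intro f g hf hg
    simp only [dif_pos hf, dif_pos hg, dif_pos (hf.mul hg)]
    refine homeomorph_OmegaBar_ext fun q => ?_
    simp [hΦ, hf.actF_mul hg]
  · simp only [dif_pos inF_one]
    refine homeomorph_OmegaBar_ext fun q => ?_
    simp [hΦ, actF_one]
end
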